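/- Let X be a connected graph whose isometry group acts cocompactly (finitely many orbits of vertices). For every r ≥ 0 there exists r₂ ≥ r such that for every vertex x of X, the restriction to B_X(x,r) of any isometric embedding f : B_X(x,r₂) → X coincides with the restriction of a global isometry of X. -/

import Mathlib

theorem lie_dist_map_le {V : Type*} (X : SimpleGraph V) (hc : X.Connected) (φ : X ≃g X) (a b : V) :
    X.dist (φ a) (φ b) ≤ X.dist a b := by
  obtain ⟨p, hp⟩ := hc.exists_walk_length_eq_dist a b
  have := SimpleGraph.dist_le (p.map φ.toHom)
  rw [SimpleGraph.Walk.length_map, hp] at this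
  exact this

theorem lie_dist_map {V : Type*} (X : SimpleGraph V) (hc : X.Connected) (φ : X ≃g X) (a b : V) :
    X.dist (φ a) (φ b) = X.dist a b := by
  apply le_antisymm (lie_dist_map_le X hc φ a b)
  have := lie_dist_map_le X hc φ.symm (φ a) (φ b)
  simpa using this

theorem lie_ball_finite {V : Type*} (X : SimpleGraph V)
    (hc : X.Connected) (hlf : ∀ v, (X.neighborSet v).Finite) (v : V) (n : ℕ) :
    {b | X.dist v b ≤ n}.Finite := by
  induction n with
  | zero =>
    apply (Set.finite_singleton v).subset
    intro b hb
    have h0 : X.dist v b = 0 := by simpa using hb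
    exact (hc.dist_eq_zero_iff.mp h0).symm
  | succ n ih =>
    apply (ih.union (ih.biUnion fun w _ => hlf w)).subset
    intro b hb
    by_cases hbn : X.dist v b ≤ n
    · exact Or.inl hbn
    · right
      have hd : X.dist b v = n + 1 := by
        rw [SimpleGraph.dist_comm]
        have : X.dist v b ≤ n + 1 := hb
        omega
      obtain ⟨p, hp⟩ := hc.exists_walk_length_eq_dist b v
      rw [hd] at hp
      cases p with
      | nil => simp at hp
      | cons h q =>
        rename_i w
        simp only [SimpleGraph.Walk.length_cons] at hp
        have := SimpleGraph.dist_le q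
        refine Set.mem_biUnion (x := w) ?_ ?_
        · change X.dist v w ≤ n
          rw [SimpleGraph.dist_comm]; omega
        · exact h.symm

/-- A global isometric self-embedding is an automorphism. -/
theorem lie_global {V : Type*} (X : SimpleGraph V)
    (hc : X.Connected) (hlf : ∀ v, (X.neighborSet v).Finite)
    (hco : ∃ F : Finset V, ∀ v : V, ∃ φ : X ≃g X, φ v ∈ F)
    (g : V → V) (hg : ∀ a b, X.dist (g a) (g b) = X.dist a b) :
    ∃ φ : X ≃g X, ∀ a, g a = φ a := by
  obtain ⟨F, hF⟩ := hco
  have hinj : Function.Injective g := by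
    intro a b hab
    have := hg a b
    rw [hab, SimpleGraph.dist_self] at this
    exact hc.dist_eq_zero_iff.mp this.symm
  let s : V → ℕ → ℕ := fun v n => {b | X.dist v b ≤ n}.ncard
  have hs : ∀ (φ : X ≃g X) v, s v ≤ s (φ v) := by
    intro φ v n
    refine Set.ncard_le_ncard_of_injOn φ ?_ φ.injective.injOn (lie_ball_finite X hc hlf _ _)
    intro b hb
    change X.dist (φ v) (φ b) ≤ n
    rw [lie_dist_map X hc]; exact hb
  have hs' : ∀ (φ : X ≃g X) v, s (φ v) ≤ s v := by
    intro φ v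
    simpa using hs φ.symm (φ v)
  have hFne : F.Nonempty := by
    obtain ⟨v⟩ := hc.nonempty
    obtain ⟨φ, h⟩ := hF v
    exact ⟨_, h⟩
  obtain ⟨v, hvF, hv⟩ := F.exists_maximalFor s hFne
  have hsub : ∀ n, g '' {b | X.dist v b ≤ n} ⊆ {b | X.dist (g v) b ≤ n} := by
    rintro n _ ⟨b, hb, rfl⟩
    change X.dist (g v) (g b) ≤ n
    rw [hg]; exact hb
  have hle : s v ≤ s (g v) := by
    intro n
    refine Set.ncard_le_ncard_of_injOn g ?_ hinj.injOn (lie_ball_finite X hc hlf _ _)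
    intro b hb
    exact hsub n ⟨b, hb, rfl⟩
  have hge : s (g v) ≤ s v := by
    obtain ⟨φ, h⟩ := hF (g v)
    exact (hs φ (g v)).trans (hv h (hle.trans (hs φ (g v))))
  have hsurj : Function.Surjective g := by
    intro y
    have := Set.eq_of_subset_of_ncard_le (hsub (X.dist (g v) y))
      (by rw [Set.ncard_image_of_injective _ hinj]; exact hge _)
      (lie_ball_finite X hc hlf _ _)
    have hy : y ∈ {b | X.dist (g v) b ≤ X.dist (g v) y} := le_refl (X.dist (g v) y)
    rw [← this] at hy
    obtain ⟨b, -, hb⟩ := hy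
    exact ⟨b, hb⟩
  refine ⟨⟨Equiv.ofBijective g ⟨hinj, hsurj⟩, ?_⟩, fun a => rfl⟩
  intro a b
  change X.Adj (g a) (g b) ↔ X.Adj a b
  rw [← SimpleGraph.dist_eq_one_iff_adj, hg, SimpleGraph.dist_eq_one_iff_adj]

theorem lie_ultra {V : Type*} (U : Ultrafilter ℕ) (u : ℕ → V) (S : Set V) (hS : S.Finite)
    (h : ∀ᶠ n in (U : Filter ℕ), u n ∈ S) : ∃ b, ∀ᶠ n in (U : Filter ℕ), u n = b := by
  have : (⋃ b ∈ S, {n | u n = b}) ∈ U := by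
    filter_upwards [h] with n hn
    exact Set.mem_biUnion hn rfl
  obtain ⟨b, -, hb⟩ := (Ultrafilter.finite_biUnion_mem_iff hS).mp this
  exact ⟨b, hb⟩

/-- Let `X` be a connected, locally finite graph whose isometry (automorphism)
group acts cocompactly, i.e. with finitely many orbits of vertices. For every
`r ≥ 0` there exists `r₂ ≥ r` such that for every vertex `x`, the restriction
to `B(x, r)` of any isometric embedding `f : B(x, r₂) → X` coincides with the
restriction of a global isometry of `X`. -/
theorem local_isometry_extends {V : Type*} (X : SimpleGraph V)
    (hXc : X.Connected) (hXlf : ∀ v, (X.neighborSet v).Finite)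
    (hcocompact : ∃ F : Finset V, ∀ v : V, ∃ φ : X ≃g X, φ v ∈ F) :
    ∀ r : ℕ, ∃ r₂ : ℕ, r ≤ r₂ ∧
      ∀ (x : V) (f : V → V),
        (∀ a b : V, X.dist x a ≤ r₂ → X.dist x b ≤ r₂ →
          X.dist (f a) (f b) = X.dist a b) →
        ∃ φ : X ≃g X, ∀ a : V, X.dist x a ≤ r → f a = φ a := by
  intro r
  by_contra hcon
  push Not at hcon
  obtain ⟨F, hF⟩ := hcocompact
  have hbad : ∀ n : ℕ, ∃ (x : V) (f : V → V), x ∈ F ∧ f x ∈ F ∧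
      (∀ a b : V, X.dist x a ≤ r + n → X.dist x b ≤ r + n →
          X.dist (f a) (f b) = X.dist a b) ∧
      ¬ ∃ φ : X ≃g X, ∀ a : V, X.dist x a ≤ r → f a = φ a := by
    intro n
    obtain ⟨x, f, hf, hno⟩ := hcon (r + n) (by omega)
    obtain ⟨φ, hφ⟩ := hF x
    obtain ⟨ψ, hψ⟩ := hF (f x)
    have key : ∀ a, X.dist x (φ.symm a) = X.dist (φ x) a := by
      intro a
      rw [← lie_dist_map X hXc φ]; simp
    refine ⟨φ x, fun a => ψ (f (φ.symm a)), hφ, by simpa using hψ, ?_, ?_⟩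
    · intro a b ha hb
      rw [lie_dist_map X hXc, hf _ _ (by rw [key]; exact ha) (by rw [key]; exact hb),
        lie_dist_map X hXc]
    · rintro ⟨θ, hθ⟩
      obtain ⟨a, ha, hne⟩ := hno ((φ.trans θ).trans ψ.symm)
      apply hne
      have := hθ (φ a) (by rw [lie_dist_map X hXc]; exact ha)
      have h2 : ψ (f a) = θ (φ a) := by simpa using this
      change f a = ψ.symm (θ (φ a))
      rw [← h2]; simp
  choose x f hx hfx hf hno using hbad
  let U : Ultrafilter ℕ := Filter.hyperfilter ℕ
  have hU : ∀ N : ℕ, ∀ᶠ n in (U : Filter ℕ), N ≤ n := by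
    intro N
    have : (U : Filter ℕ) ≤ Filter.atTop := by
      rw [← Nat.cofinite_eq_atTop]; exact Filter.hyperfilter_le_cofinite
    exact this (Filter.eventually_ge_atTop N)
  obtain ⟨x₀, hx₀⟩ := lie_ultra U x F F.finite_toSet (Filter.Eventually.of_forall hx)
  obtain ⟨y₀, hy₀⟩ := lie_ultra U (fun n => f n (x n)) F F.finite_toSet
    (Filter.Eventually.of_forall hfx)
  have hlim : ∀ a, ∃ b, ∀ᶠ n in (U : Filter ℕ), f n a = b := by
    intro a
    apply lie_ultra U _ _ (lie_ball_finite X hXc hXlf y₀ (X.dist x₀ a))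
    filter_upwards [hx₀, hy₀, hU (X.dist x₀ a)] with n h1 h2 h3
    have := hf n (x n) a (by simp) (by rw [h1]; omega)
    rw [h2, h1] at this
    exact this.le
  choose g hg using hlim
  have hiso : ∀ a b, X.dist (g a) (g b) = X.dist a b := by
    intro a b
    have : ∀ᶠ n in (U : Filter ℕ), X.dist (g a) (g b) = X.dist a b := by
      filter_upwards [hx₀, hg a, hg b, hU (X.dist x₀ a), hU (X.dist x₀ b)] with n h1 h2 h3 h4 h5
      rw [← h2, ← h3]
      exact hf n a b (by rw [h1]; omega) (by rw [h1]; omega)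
    exact this.exists.choose_spec
  obtain ⟨φ, hφ⟩ := lie_global X hXc hXlf ⟨F, hF⟩ g hiso
  have hall : ∀ᶠ n in (U : Filter ℕ), ∀ a ∈ {b | X.dist x₀ b ≤ r}, f n a = g a :=
    (Filter.eventually_all_finite (lie_ball_finite X hXc hXlf x₀ r)).mpr fun a _ => hg a
  obtain ⟨n, h1, h2⟩ := (hx₀.and hall).exists
  exact hno n ⟨φ, fun a ha => by rw [h2 a (by rw [← h1]; exact ha), hφ]⟩
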